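/- For every integer k ≥ 1, the polynomials x^k·y, x^k·z, x·y^k, y^k·z, x·z^k and y·z^k all belong to L. -/

import Mathlib

open MvPolynomial

/-- The defining polynomial `f = x² + y² + z² + Exyz − Ax − By − Cz − D` of the
Markov-type surface. -/
noncomputable def markovPoly (A B C D E : ℂ) : MvPolynomial (Fin 3) ℂ :=
  X 0 ^ 2 + X 1 ^ 2 + X 2 ^ 2 + MvPolynomial.C E * X 0 * X 1 * X 2
    - MvPolynomial.C A * X 0 - MvPolynomial.C B * X 1 - MvPolynomial.C C * X 2
    - MvPolynomial.C D

/-- The Poisson bracket on `ℂ[x,y,z]` induced by the Markov-type surface: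
`{g,h} = f_x·(g_y h_z − g_z h_y) + f_y·(g_z h_x − g_x h_z) + f_z·(g_x h_y − g_y h_x)`,
where `f` is the defining polynomial of the surface. -/
noncomputable def markovBracket (A B C D E : ℂ) (g h : MvPolynomial (Fin 3) ℂ) :
    MvPolynomial (Fin 3) ℂ :=
  pderiv 0 (markovPoly A B C D E) * (pderiv 1 g * pderiv 2 h - pderiv 2 g * pderiv 1 h)
  + pderiv 1 (markovPoly A B C D E) * (pderiv 2 g * pderiv 0 h - pderiv 0 g * pderiv 2 h)
  + pderiv 2 (markovPoly A B C D E) * (pderiv 0 g * pderiv 1 h - pderiv 1 g * pderiv 0 h)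

/-- The Leibniz rule for the bracket of a power. -/
lemma markovBracket_pow_succ (A B C D E : ℂ) (g h : MvPolynomial (Fin 3) ℂ) (m : ℕ) :
    markovBracket A B C D E (g ^ (m + 1)) h =
      ((m : ℂ) + 1) • (g ^ m * markovBracket A B C D E g h) := by
  simp only [markovBracket, pderiv_pow, MvPolynomial.smul_eq_C_mul, map_add, map_one,
    map_natCast, Nat.add_sub_cancel, Nat.cast_add, Nat.cast_one]
  ring

lemma markovBracket_swap (A B C D E : ℂ) (g h : MvPolynomial (Fin 3) ℂ) :
    markovBracket A B C D E h g = -markovBracket A B C D E g h := by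
  simp only [markovBracket]
  ring

lemma markovBracket_X_zero_X_one (A B C D E : ℂ) :
    markovBracket A B C D E (X 0) (X 1) =
      2 * X 2 + MvPolynomial.C E * (X 0 * X 1) - MvPolynomial.C C := by
  simp [markovBracket, markovPoly, pderiv_X]
  ring

lemma markovBracket_X_one_X_two (A B C D E : ℂ) :
    markovBracket A B C D E (X 1) (X 2) =
      2 * X 0 + MvPolynomial.C E * (X 1 * X 2) - MvPolynomial.C A := by
  simp [markovBracket, markovPoly, pderiv_X]
  ring

lemma markovBracket_X_two_X_zero (A B C D E : ℂ) :
    markovBracket A B C D E (X 2) (X 0) =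
      2 * X 1 + MvPolynomial.C E * (X 2 * X 0) - MvPolynomial.C B := by
  simp [markovBracket, markovPoly, pderiv_X]
  ring

/-- If a subspace closed under the bracket contains `b`, `c` and all powers of `a`, where
`{a, b} = 2c + Eab − γ` and `{c, a} = 2b + Eca − β`, then it contains `a ^ m * b` and
`a ^ m * c` for all `m`. -/
lemma pow_mul_mem_of_markovBracket {A B C D E : ℂ} (hE : E ≠ 0)
    {L : Submodule ℂ (MvPolynomial (Fin 3) ℂ)}
    (hbr : ∀ g h : MvPolynomial (Fin 3) ℂ, g ∈ L → h ∈ L → markovBracket A B C D E g h ∈ L)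
    {a b c : MvPolynomial (Fin 3) ℂ} {β γ : ℂ} (ha : ∀ m : ℕ, a ^ m ∈ L)
    (hb : b ∈ L) (hc : c ∈ L)
    (hab : markovBracket A B C D E a b =
      2 * c + MvPolynomial.C E * (a * b) - MvPolynomial.C γ)
    (hca : markovBracket A B C D E c a =
      2 * b + MvPolynomial.C E * (c * a) - MvPolynomial.C β) (m : ℕ) :
    a ^ m * b ∈ L ∧ a ^ m * c ∈ L := by
  have hbracket (m : ℕ) {h : MvPolynomial (Fin 3) ℂ} (hh : h ∈ L) :
      a ^ m * markovBracket A B C D E a h ∈ L := by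
    have hmem := hbr _ _ (ha (m + 1)) hh
    rw [markovBracket_pow_succ] at hmem
    exact (L.smul_mem_iff (Nat.cast_add_one_ne_zero m)).1 hmem
  induction m with
  | zero => simpa using ⟨hb, hc⟩
  | succ m ih =>
    constructor
    · refine (L.smul_mem_iff hE).1 ?_
      convert L.add_mem (L.sub_mem (hbracket m hb) (L.smul_mem 2 ih.2)) (L.smul_mem γ (ha m))
        using 1
      rw [hab]
      simp only [MvPolynomial.smul_eq_C_mul, map_ofNat]
      ring
    · refine (L.smul_mem_iff hE).1 ?_
      convert L.add_mem (L.sub_mem (L.neg_mem (hbracket m hc)) (L.smul_mem 2 ih.1))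
        (L.smul_mem β (ha m)) using 1
      rw [markovBracket_swap, hca]
      simp only [MvPolynomial.smul_eq_C_mul, map_ofNat]
      ring

/-- For every integer `k ≥ 1`, the polynomials `x^k y`, `x^k z`, `x y^k`, `y^k z`,
`x z^k` and `y z^k` all belong to `L`, where `L` is the smallest ℂ-linear subspace of
`ℂ[x,y,z]` containing the ideal `(f)`, the constant `1` and all powers
`x^m, y^m, z^m` (`m ≥ 1`), and closed under the Poisson bracket. (Formalized by
quantifying over all such subspaces `L`.) -/
theorem monomials_deg_kplus1_mem (A B C D E : ℂ) (hE : E ≠ 0) (k : ℕ) (hk : 1 ≤ k)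
    (L : Submodule ℂ (MvPolynomial (Fin 3) ℂ))
    (hIdeal : ∀ p ∈ Ideal.span {markovPoly A B C D E}, p ∈ L)
    (hone : (1 : MvPolynomial (Fin 3) ℂ) ∈ L)
    (hxpow : ∀ m : ℕ, 1 ≤ m → (X 0 : MvPolynomial (Fin 3) ℂ) ^ m ∈ L)
    (hypow : ∀ m : ℕ, 1 ≤ m → (X 1 : MvPolynomial (Fin 3) ℂ) ^ m ∈ L)
    (hzpow : ∀ m : ℕ, 1 ≤ m → (X 2 : MvPolynomial (Fin 3) ℂ) ^ m ∈ L)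
    (hbr : ∀ g h : MvPolynomial (Fin 3) ℂ, g ∈ L → h ∈ L → markovBracket A B C D E g h ∈ L) :
    (X 0 : MvPolynomial (Fin 3) ℂ) ^ k * X 1 ∈ L ∧
    (X 0 : MvPolynomial (Fin 3) ℂ) ^ k * X 2 ∈ L ∧
    (X 0 : MvPolynomial (Fin 3) ℂ) * X 1 ^ k ∈ L ∧
    (X 1 : MvPolynomial (Fin 3) ℂ) ^ k * X 2 ∈ L ∧
    (X 0 : MvPolynomial (Fin 3) ℂ) * X 2 ^ k ∈ L ∧
    (X 1 : MvPolynomial (Fin 3) ℂ) * X 2 ^ k ∈ L := by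
  have hpow {a : MvPolynomial (Fin 3) ℂ} (ha : ∀ m : ℕ, 1 ≤ m → a ^ m ∈ L) (m : ℕ) :
      a ^ m ∈ L := by
    rcases m.eq_zero_or_pos with rfl | hm
    · simpa using hone
    · exact ha m hm
  have hx : (X 0 : MvPolynomial (Fin 3) ℂ) ∈ L := by simpa using hxpow 1 le_rfl
  have hy : (X 1 : MvPolynomial (Fin 3) ℂ) ∈ L := by simpa using hypow 1 le_rfl
  have hz : (X 2 : MvPolynomial (Fin 3) ℂ) ∈ L := by simpa using hzpow 1 le_rfl
  have hxy := markovBracket_X_zero_X_one A B C D E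
  have hyz := markovBracket_X_one_X_two A B C D E
  have hzx := markovBracket_X_two_X_zero A B C D E
  obtain ⟨h₁, h₂⟩ := pow_mul_mem_of_markovBracket hE hbr (hpow hxpow) hy hz hxy hzx k
  obtain ⟨h₃, h₄⟩ := pow_mul_mem_of_markovBracket hE hbr (hpow hypow) hz hx hyz hxy k
  obtain ⟨h₅, h₆⟩ := pow_mul_mem_of_markovBracket hE hbr (hpow hzpow) hx hy hzx hyz k
  exact ⟨h₁, h₂, by rwa [mul_comm], h₃, by rwa [mul_comm], by rwa [mul_comm]⟩
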